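/- Let A be a commutative ring, 𝔞 ⊆ A[x₁,…,xₙ] a nonzero ideal, and G a monic Gröbner basis of 𝔞 with respect to a monomial order ≺. If for some index i ∈ {1,…,n} no element g ∈ G has lm(g) equal to a pure power xᵢ^ν of xᵢ, then the residue classes 1 + 𝔞, xᵢ + 𝔞, xᵢ² + 𝔞, … of the powers of xᵢ are A-linearly independent in A[x₁,…,xₙ]/𝔞; in particular A[x₁,…,xₙ]/𝔞 does not have finite rank as a free A-module. -/

import Mathlib

open MvPolynomial

namespace GB

variable {σ A : Type*} [CommRing A]

/-- Leading monomial (exponent vector) of `f` w.r.t. the monomial order `m`. -/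
noncomputable def lm (m : MonomialOrder σ) (f : MvPolynomial σ A) : σ →₀ ℕ :=
  m.toSyn.symm (f.support.sup fun α => m.toSyn α)

/-- Leading coefficient of `f` w.r.t. `m`. -/
noncomputable def lc (m : MonomialOrder σ) (f : MvPolynomial σ A) : A :=
  f.coeff (lm m f)

/-- Leading term of `f` w.r.t. `m`. -/
noncomputable def lt (m : MonomialOrder σ) (f : MvPolynomial σ A) : MvPolynomial σ A :=
  monomial (lm m f) (lc m f)

/-- `G` is a Gröbner basis of the ideal `I` w.r.t. the monomial order `m`:
`G ⊆ I` and `⟨lt f : f ∈ I, f ≠ 0⟩ = ⟨lt g : g ∈ G⟩`. -/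
def IsGrobnerBasis (m : MonomialOrder σ) (I : Ideal (MvPolynomial σ A))
    (G : Finset (MvPolynomial σ A)) : Prop :=
  (G : Set (MvPolynomial σ A)) ⊆ I ∧
    Ideal.span (lt m '' {f : MvPolynomial σ A | f ∈ I ∧ f ≠ 0}) =
      Ideal.span (lt m '' (G : Set (MvPolynomial σ A)))

/-- `G` is monic: every element has leading coefficient `1`. -/
def IsMonic (m : MonomialOrder σ) (G : Finset (MvPolynomial σ A)) : Prop :=
  ∀ g ∈ G, lc m g = 1

/-- The border of an order ideal `O` of monomials:
`∂O = (x₁·O ∪ ⋯ ∪ xₙ·O) \ O`. -/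
def border {n : ℕ} (O : Set (Fin n →₀ ℕ)) : Set (Fin n →₀ ℕ) :=
  (⋃ i : Fin n, (fun α => α + Finsupp.single i 1) '' O) \ O

end GB
namespace MvPolynomial

theorem coeff_single_linearCombination_X_pow {σ A : Type*} [CommRing A] (i : σ) (l : ℕ →₀ A)
    (k : ℕ) :
    coeff (Finsupp.single i k)
      (Finsupp.linearCombination A (fun k : ℕ => (X i : MvPolynomial σ A) ^ k) l) = l k := by
  classical
  simp +contextual [Finsupp.linearCombination_apply, Finsupp.sum, coeff_sum, coeff_X_pow,
    (Finsupp.single_injective i).eq_iff]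

theorem exists_eq_single_of_mem_support_linearCombination_X_pow {σ A : Type*} [CommRing A]
    (i : σ) (l : ℕ →₀ A) {d : σ →₀ ℕ}
    (hd : d ∈ (Finsupp.linearCombination A
      (fun k : ℕ => (X i : MvPolynomial σ A) ^ k) l).support) :
    ∃ k, d = Finsupp.single i k := by
  classical
  by_contra! h
  refine mem_support_iff.mp hd ?_
  simp [Finsupp.linearCombination_apply, Finsupp.sum, coeff_sum, coeff_X_pow,
    fun k => (h k).symm]

end MvPolynomial

namespace GB

variable {σ A : Type*} [CommRing A]

theorem lm_mem_support (m : MonomialOrder σ) {f : MvPolynomial σ A} (hf : f ≠ 0) :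
    lm m f ∈ f.support :=
  m.degree_mem_support hf

/-- The leading monomial of a nonzero element of `I` is divisible by the leading monomial of
some element of a monic Gröbner basis of `I`. -/
theorem IsGrobnerBasis.exists_lm_le {m : MonomialOrder σ} {I : Ideal (MvPolynomial σ A)}
    {G : Finset (MvPolynomial σ A)} (hG : IsGrobnerBasis m I G) (hmonic : IsMonic m G)
    {f : MvPolynomial σ A} (hfI : f ∈ I) (hf : f ≠ 0) :
    ∃ g ∈ G, lm m g ≤ lm m f := by
  classical
  have hmem : lt m f ∈ Ideal.span (lt m '' (G : Set (MvPolynomial σ A))) :=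
    hG.2 ▸ Ideal.subset_span ⟨f, ⟨hfI, hf⟩, rfl⟩
  have himage : lt m '' (G : Set (MvPolynomial σ A)) =
      (fun s => monomial s (1 : A)) '' (lm m '' (G : Set (MvPolynomial σ A))) := by
    rw [Set.image_image]
    exact Set.image_congr fun g hg => by rw [lt, hmonic g hg]
  rw [himage, mem_ideal_span_monomial_image] at hmem
  have hlc : lc m f ≠ 0 := mem_support_iff.mp (lm_mem_support m hf)
  obtain ⟨_, ⟨g, hg, rfl⟩, hle⟩ := hmem (lm m f) (by simpa [lt, mem_support_iff] using hlc)
  exact ⟨g, hg, hle⟩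

end GB

/-- If no leading monomial of the monic Gröbner basis `G` is a pure power of `xᵢ`,
then the residue classes of the powers of `xᵢ` are `A`-linearly independent in the
quotient; in particular the quotient is not a finite `A`-module. -/
theorem powers_linearIndependent_of_no_pure_power
    {n : ℕ} {A : Type*} [CommRing A] (m : MonomialOrder (Fin n))
    (𝔞 : Ideal (MvPolynomial (Fin n) A)) (h𝔞 : 𝔞 ≠ ⊥)
    (G : Finset (MvPolynomial (Fin n) A))
    (hG : GB.IsGrobnerBasis m 𝔞 G) (hmonic : GB.IsMonic m G)
    (i : Fin n) (hi : ∀ g ∈ G, ∀ ν : ℕ, GB.lm m g ≠ Finsupp.single i ν) :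
    LinearIndependent A
      (fun k : ℕ => Ideal.Quotient.mk 𝔞 ((X i : MvPolynomial (Fin n) A) ^ k)) ∧
    ¬ Module.Finite A (MvPolynomial (Fin n) A ⧸ 𝔞) := by
  have hnt : Nontrivial A := by
    by_contra h
    rw [not_nontrivial_iff_subsingleton] at h
    exact h𝔞 (Subsingleton.elim _ _)
  have hli : LinearIndependent A
      (fun k : ℕ => Ideal.Quotient.mk 𝔞 ((X i : MvPolynomial (Fin n) A) ^ k)) := by
    rw [linearIndependent_iff]
    intro l hl
    set f := Finsupp.linearCombination A
      (fun k : ℕ => (X i : MvPolynomial (Fin n) A) ^ k) l with hf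
    have hf𝔞 : f ∈ 𝔞 := by
      rw [← Ideal.Quotient.eq_zero_iff_mem, ← hl]
      exact Finsupp.apply_linearCombination A (Ideal.Quotient.mkₐ A 𝔞).toLinearMap _ l
    have hf0 : f = 0 := by
      by_contra hne
      obtain ⟨k, hk⟩ := exists_eq_single_of_mem_support_linearCombination_X_pow i l
        (GB.lm_mem_support m hne)
      obtain ⟨g, hg, hle⟩ := hG.exists_lm_le hmonic hf𝔞 hne
      rw [hk] at hle
      refine hi g hg (GB.lm m g i) ?_
      exact Finsupp.support_subset_singleton.mp
        ((Finsupp.support_mono hle).trans Finsupp.support_single_subset)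
    ext k
    rw [← coeff_single_linearCombination_X_pow i l k, ← hf, hf0, coeff_zero, Finsupp.zero_apply]
  refine ⟨hli, fun _ => ?_⟩
  have := hli.finite
  exact not_finite ℕ
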